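/- Suppose y = Ax*, supp(x) ⊆ S where S = supp(x*), W ∈ ℝ^{n×m} satisfies W_iᵀ a_i = 1 for all i and |W_iᵀ a_j| ≤ μ for all i ≠ j, α ≥ 0, and the threshold satisfies θ ≥ α·μ·‖x − x*‖₁. Then the updated point x⁺ = ST(x − αW(Ax − y), θ) satisfies supp(x⁺) ⊆ S; i.e., the tied thresholded gradient step produces no entries outside the true support. -/

import Mathlib

/-- The soft-thresholding operator, defined componentwise by
`ST(v,θ)_i = sign(v_i) · max(|v_i| − θ, 0)`. -/
noncomputable def softThreshold {n : ℕ} (v : Fin n → ℝ) (θ : ℝ) : Fin n → ℝ :=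
  fun i => Real.sign (v i) * max (|v i| - θ) 0

theorem softThreshold_apply_eq_zero {n : ℕ} {v : Fin n → ℝ} {θ : ℝ} {i : Fin n}
    (h : |v i| ≤ θ) : softThreshold v θ i = 0 := by
  simp [softThreshold, max_eq_right (sub_nonpos.mpr h)]

/-- If the off-diagonal entries of row `i` of `M` are bounded by `μ` and `d i = 0`, then
`|(M d)_i| ≤ μ ‖d‖₁`. -/
theorem abs_mulVec_apply_le {ι : Type*} [Fintype ι] (M : Matrix ι ι ℝ) (d : ι → ℝ)
    {μ : ℝ} {i : ι} (hM : ∀ j, i ≠ j → |M i j| ≤ μ) (hd : d i = 0) :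
    |M.mulVec d i| ≤ μ * ∑ j, |d j| := by
  rw [Finset.mul_sum]
  refine (Finset.abs_sum_le_sum_abs _ _).trans (Finset.sum_le_sum fun j _ => ?_)
  rw [abs_mul]
  by_cases hij : i = j
  · simp [← hij, hd]
  · exact mul_le_mul_of_nonneg_right (hM j hij) (abs_nonneg _)

/-- No false positives of a tied thresholded gradient step: in the noiseless model
`y = Ax*`, if `supp(x) ⊆ S = supp(x*)`, the rows of `W` satisfy `W_iᵀ a_i = 1` and
`|W_iᵀ a_j| ≤ μ` for `i ≠ j`, `α ≥ 0`, and `θ ≥ α·μ·‖x − x*‖₁`, then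
`x⁺ = ST(x − αW(Ax − y), θ)` satisfies `supp(x⁺) ⊆ S`. -/
theorem no_false_positives {m n : ℕ} (A : Matrix (Fin m) (Fin n) ℝ)
    (W : Matrix (Fin n) (Fin m) ℝ) (xstar x : Fin n → ℝ)
    (yobs : Fin m → ℝ) (μ α θ : ℝ)
    (hy : yobs = A.mulVec xstar)
    (hsupp : ∀ i : Fin n, x i ≠ 0 → xstar i ≠ 0)
    (hWdiag : ∀ i : Fin n, ∑ k, W i k * A k i = 1)
    (hWoff : ∀ i j : Fin n, i ≠ j → |∑ k, W i k * A k j| ≤ μ)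
    (hα : 0 ≤ α)
    (hθ : θ ≥ α * μ * ∑ i, |x i - xstar i|) :
    ∀ i : Fin n,
      softThreshold (x - α • W.mulVec (A.mulVec x - yobs)) θ i ≠ 0 → xstar i ≠ 0 := by
  intro i
  contrapose!
  intro hi
  have hxi : x i = 0 := not_not.mp fun h => hsupp i h hi
  apply softThreshold_apply_eq_zero
  have hbound := abs_mulVec_apply_le (W * A) (x - xstar) (hWoff i) (by simp [hxi, hi])
  rw [hy, ← Matrix.mulVec_sub, Matrix.mulVec_mulVec, Pi.sub_apply, hxi, zero_sub, abs_neg,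
    Pi.smul_apply, smul_eq_mul, abs_mul, abs_of_nonneg hα]
  refine (mul_le_mul_of_nonneg_left hbound hα).trans ?_
  simpa only [Pi.sub_apply, mul_assoc] using hθ
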